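/- In coordinates (u,v,w) on ℝ³, let B be the second Hamiltonian structure of the KdV equation: its leading coefficient is the constant symmetric matrix g_B with entries g_B^{11} = g_B^{13} = g_B^{31} = g_B^{33} = 1/2 and all other entries 0, and its ultralocal part is the skew-symmetric matrix field ω_B with ω_B^{12} = u − w + 1/√2, ω_B^{23} = w − u + 1/√2, ω_B^{13} = 0 (and ω_B^{ji} = −ω_B^{ij}). Then a smooth function F : ℝ³ → ℝ satisfies the hydrodynamic Casimir system for B — namely Σ_s g_B^{is} ∂²F/∂u^s∂u^k = 0 for all i,k and Σ_s ω_B^{is} ∂F/∂u^s = 0 for all i, at every point of ℝ³ — if and only if there exist constants α, β ∈ ℝ such that F(u,v,w) = α ( (u − w)² − √2 (u + w) ) + β for all (u,v,w) ∈ ℝ³. -/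

import Mathlib

open scoped BigOperators

/-- Partial derivative in the `i`-th coordinate direction on `ℝⁿ`. -/
noncomputable def pd {n : ℕ} (i : Fin n) (f : (Fin n → ℝ) → ℝ) : (Fin n → ℝ) → ℝ :=
  fun u => fderiv ℝ f u (Pi.single i 1)

/-- Leading coefficient of the second Hamiltonian structure `B` of the KdV equation. -/
noncomputable def gKdV : Matrix (Fin 3) (Fin 3) ℝ :=
  !![1/2, 0, 1/2; 0, 0, 0; 1/2, 0, 1/2]

/-- Ultralocal part of the second Hamiltonian structure `B` of the KdV equation,
in the coordinates `(u, v, w) = (x 0, x 1, x 2)`. -/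
noncomputable def ωKdV (x : Fin 3 → ℝ) : Matrix (Fin 3) (Fin 3) ℝ :=
  !![0, x 0 - x 2 + 1 / Real.sqrt 2, 0;
     -(x 0 - x 2 + 1 / Real.sqrt 2), 0, x 2 - x 0 + 1 / Real.sqrt 2;
     0, -(x 2 - x 0 + 1 / Real.sqrt 2), 0]

lemma fderiv_eq_zero_of_pd_eq_zero {n : ℕ} {f : (Fin n → ℝ) → ℝ} {x : Fin n → ℝ}
    (h : ∀ i, pd i f x = 0) : fderiv ℝ f x = 0 := by
  apply ContinuousLinearMap.coe_injective
  refine LinearMap.pi_ext' fun i => LinearMap.ext_ring ?_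
  simpa [pd] using h i

lemma eq_of_pd_eq_zero {n : ℕ} {f : (Fin n → ℝ) → ℝ} (hf : Differentiable ℝ f)
    (h : ∀ x i, pd i f x = 0) (x y : Fin n → ℝ) : f x = f y :=
  is_const_of_fderiv_eq_zero hf (fun z => fderiv_eq_zero_of_pd_eq_zero (h z)) x y

lemma pd_add {n : ℕ} {f g : (Fin n → ℝ) → ℝ} (hf : Differentiable ℝ f)
    (hg : Differentiable ℝ g) (i : Fin n) (x : Fin n → ℝ) :
    pd i (fun y => f y + g y) x = pd i f x + pd i g x := by
  simp [pd, fderiv_fun_add (hf x) (hg x)]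

lemma pd_sub {n : ℕ} {f g : (Fin n → ℝ) → ℝ} (hf : Differentiable ℝ f)
    (hg : Differentiable ℝ g) (i : Fin n) (x : Fin n → ℝ) :
    pd i (fun y => f y - g y) x = pd i f x - pd i g x := by
  simp [pd, fderiv_fun_sub (hf x) (hg x)]

lemma differentiable_pd {n : ℕ} {f : (Fin n → ℝ) → ℝ} (hf : ContDiff ℝ 2 f) (i : Fin n) :
    Differentiable ℝ (pd i f) :=
  ((hf.fderiv_right (m := 1) (by norm_num)).differentiable (by norm_num)).clm_apply
    (differentiable_const _)

lemma pd_comm {n : ℕ} {f : (Fin n → ℝ) → ℝ} (hf : ContDiff ℝ 2 f) (i j : Fin n)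
    (x : Fin n → ℝ) : pd i (pd j f) x = pd j (pd i f) x := by
  have hd : DifferentiableAt ℝ (fderiv ℝ f) x :=
    (hf.fderiv_right (m := 1) (by norm_num)).differentiable (by norm_num) x
  have key : ∀ a b : Fin n, pd a (pd b f) x
      = fderiv ℝ (fderiv ℝ f) x (Pi.single a 1) (Pi.single b 1) := by
    intro a b
    have h := hd.hasFDerivAt.clm_apply
      (hasFDerivAt_const (Pi.single b (1 : ℝ) : Fin n → ℝ) x)
    change fderiv ℝ (fun y => fderiv ℝ f y (Pi.single b 1)) x (Pi.single a 1) = _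
    rw [h.fderiv]
    simp
  rw [key, key]
  exact (hf.contDiffAt.isSymmSndFDerivAt (by simp)).eq _ _

/-- The family of quadratic functions spanned by the Casimir and the constants. -/
noncomputable def kdvCasimir (α β : ℝ) (x : Fin 3 → ℝ) : ℝ :=
  α * ((x 0 - x 2) ^ 2 - Real.sqrt 2 * (x 0 + x 2)) + β

lemma differentiable_kdvCasimir (α β : ℝ) : Differentiable ℝ (kdvCasimir α β) := by
  unfold kdvCasimir
  fun_prop

lemma pd_affine (a b c : ℝ) (i : Fin 3) (x : Fin 3 → ℝ) :
    pd i (fun y : Fin 3 → ℝ => a * y 0 + b * y 2 + c) x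
      = a * (Pi.single i 1 : Fin 3 → ℝ) 0 + b * (Pi.single i 1 : Fin 3 → ℝ) 2 := by
  have h := (((hasFDerivAt_apply (𝕜 := ℝ) (0 : Fin 3) x).const_mul a).add
    ((hasFDerivAt_apply (𝕜 := ℝ) (2 : Fin 3) x).const_mul b)).add_const c
  refine (congrArg (fun L => L (Pi.single i 1)) h.fderiv).trans ?_
  simp

lemma pd_kdvCasimir (α β : ℝ) (i : Fin 3) (x : Fin 3 → ℝ) :
    pd i (kdvCasimir α β) x
      = (α * (2 * (x 0 - x 2) - Real.sqrt 2)) * (Pi.single i 1 : Fin 3 → ℝ) 0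
        + (α * (-2 * (x 0 - x 2) - Real.sqrt 2)) * (Pi.single i 1 : Fin 3 → ℝ) 2 := by
  have h0 := hasFDerivAt_apply (𝕜 := ℝ) (0 : Fin 3) x
  have h2 := hasFDerivAt_apply (𝕜 := ℝ) (2 : Fin 3) x
  have h := ((((h0.sub h2).pow 2).sub ((h0.add h2).const_mul (Real.sqrt 2))).const_mul α).add_const
    β
  refine (congrArg (fun L => L (Pi.single i 1)) h.fderiv).trans ?_
  simp
  ring

lemma sum_gKdV_mul (a : Fin 3 → ℝ) (i : Fin 3) :
    ∑ s, gKdV i s * a s = gKdV i 0 * (a 0 + a 2) := by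
  fin_cases i <;> simp [gKdV, Fin.sum_univ_three] <;> ring

/-- Hydrodynamic Casimirs of the second Hamiltonian structure of the KdV equation. -/
theorem casimir_kdv_second_structure
    (F : (Fin 3 → ℝ) → ℝ) (hF : ContDiff ℝ (⊤ : ℕ∞) F) :
    ((∀ (x : Fin 3 → ℝ) (i k : Fin 3), ∑ s, gKdV i s * pd s (pd k F) x = 0)
      ∧ (∀ (x : Fin 3 → ℝ) (i : Fin 3), ∑ s, ωKdV x i s * pd s F x = 0))
      ↔ ∃ α β : ℝ, ∀ x : Fin 3 → ℝ,
          F x = α * ((x 0 - x 2) ^ 2 - Real.sqrt 2 * (x 0 + x 2)) + β := by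
  have hsq : Real.sqrt 2 * Real.sqrt 2 = 2 := Real.mul_self_sqrt (by norm_num)
  have hinv : 1 / Real.sqrt 2 = Real.sqrt 2 / 2 := by
    field_simp
    linarith
  have hpos : 0 < Real.sqrt 2 := by positivity
  constructor
  · rintro ⟨hg, hω⟩
    have hF2 : ContDiff ℝ 2 F := hF.of_le (WithTop.coe_le_coe.mpr le_top)
    have hdF : Differentiable ℝ F := hF2.differentiable (by norm_num)
    have hd := differentiable_pd hF2
    have hrow0 : ∀ x, (x 0 - x 2 + Real.sqrt 2 / 2) * pd 1 F x = 0 := fun x => by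
      simpa [ωKdV, Fin.sum_univ_three, ← hinv] using hω x 0
    have hrow2 : ∀ x, (x 2 - x 0 + Real.sqrt 2 / 2) * pd 1 F x = 0 := fun x => by
      have := hω x 2
      simp only [ωKdV, Fin.sum_univ_three, hinv] at this
      linear_combination -(by simpa using this :
        (-(Real.sqrt 2 / 2) + (x 0 - x 2)) * pd 1 F x = 0)
    have hrow1 : ∀ x, -(x 0 - x 2 + Real.sqrt 2 / 2) * pd 0 F x
        + (x 2 - x 0 + Real.sqrt 2 / 2) * pd 2 F x = 0 := fun x => by
      have := hω x 1
      simp only [ωKdV, Fin.sum_univ_three, hinv] at this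
      simpa using this
    have h1 : ∀ x, pd 1 F x = 0 := fun x => by
      have : Real.sqrt 2 * pd 1 F x = 0 := by linarith [hrow0 x, hrow2 x]
      exact (mul_eq_zero.mp this).resolve_left hpos.ne'
    have hS : ∀ x k, pd k (fun y => pd 0 F y + pd 2 F y) x = 0 := fun x k => by
      rw [pd_add (hd 0) (hd 2), pd_comm hF2 k 0, pd_comm hF2 k 2]
      have := hg x 0 k
      rw [sum_gKdV_mul (fun s => pd s (pd k F) x)] at this
      simpa [gKdV] using this
    have hconst := eq_of_pd_eq_zero ((hd 0).add (hd 2)) hS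
    obtain ⟨S, hS'⟩ : ∃ S, ∀ x, pd 0 F x + pd 2 F x = S := ⟨_, fun x => hconst x 0⟩
    have h0 : ∀ x, Real.sqrt 2 * pd 0 F x = (x 2 - x 0 + Real.sqrt 2 / 2) * S := fun x => by
      rw [← hS' x]
      linarith [hrow1 x]
    have h0' : ∀ x, pd 0 F x = Real.sqrt 2 / 2 * (x 2 - x 0 + Real.sqrt 2 / 2) * S := fun x => by
      linear_combination (Real.sqrt 2 / 2) * h0 x - (pd 0 F x / 2) * hsq
    have h2' : ∀ x, pd 2 F x = S - Real.sqrt 2 / 2 * (x 2 - x 0 + Real.sqrt 2 / 2) * S :=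
      fun x => by linarith [hS' x, h0' x]
    set α : ℝ := -(Real.sqrt 2 * S) / 4 with hα
    have hdiff : ∀ x i, pd i (fun y => F y - kdvCasimir α 0 y) x = 0 := fun x i => by
      rw [pd_sub hdF (differentiable_kdvCasimir α 0), pd_kdvCasimir, hα]
      fin_cases i
      · simp [h0' x]
        ring
      · simp [h1 x]
      · simp [h2' x]
        linear_combination (-S / 2) * hsq
    refine ⟨α, F 0 - kdvCasimir α 0 0, fun x => ?_⟩
    have := eq_of_pd_eq_zero (hdF.sub (differentiable_kdvCasimir α 0)) hdiff x 0
    simp only [Pi.sub_apply] at this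
    rw [← this, kdvCasimir]
    ring
  · rintro ⟨α, β, h⟩
    obtain rfl : F = kdvCasimir α β := funext h
    refine ⟨fun x i k => ?_, fun x i => ?_⟩
    · have hk : pd k (kdvCasimir α β) = fun y : Fin 3 → ℝ =>
          (2 * α * ((Pi.single k 1 : Fin 3 → ℝ) 0 - (Pi.single k 1 : Fin 3 → ℝ) 2)) * y 0
          + (-(2 * α * ((Pi.single k 1 : Fin 3 → ℝ) 0 - (Pi.single k 1 : Fin 3 → ℝ) 2))) * y 2
          + -(α * Real.sqrt 2
            * ((Pi.single k 1 : Fin 3 → ℝ) 0 + (Pi.single k 1 : Fin 3 → ℝ) 2)) := by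
        funext y
        rw [pd_kdvCasimir]
        ring
      rw [sum_gKdV_mul (fun s => pd s (pd k (kdvCasimir α β)) x), hk, pd_affine, pd_affine]
      simp
    · simp only [Fin.sum_univ_three, pd_kdvCasimir, ωKdV, hinv]
      fin_cases i
      · simp
      · simp
        ring
      · simp
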